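/- Fix δ > 0. As n → ∞, ln(card Π̃_{n,n+δ}) = (3^{4/3}·ζ(3)^{1/3}/(4π)^{1/3})·n^{2/3}·(1 + o(1)), where ζ(3) = ∑_{k≥1} 1/k³. -/

import Mathlib

open Real Filter Asymptotics

/-- The set of pairs of coprime nonnegative integers (including `(0,1)` and `(1,0)`). -/
abbrev Xc : Type := {x : ℕ × ℕ // Nat.gcd x.1 x.2 = 1}

/-- The total length `∑_{x∈X} ν(x)·√(x₁²+x₂²)` of the chain encoded by `ν`. -/
noncomputable def totalLength (ν : Xc →₀ ℕ) : ℝ :=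
  ν.sum fun x m => (m : ℝ) * Real.sqrt ((x.val.1 : ℝ) ^ 2 + (x.val.2 : ℝ) ^ 2)

noncomputable def zeta3 : ℝ := ∑' k : ℕ, 1 / ((k : ℝ) + 1) ^ 3

open scoped Topology

/-- The Euclidean length of a lattice vector. -/
noncomputable def latticeLen (y : ℕ × ℕ) : ℝ := √((y.1 : ℝ) ^ 2 + (y.2 : ℝ) ^ 2)

/-- The half-open unit square with lower left corner `y`. -/
def unitSquare (y : ℕ × ℕ) : Set (ℝ × ℝ) :=
  Set.Ico (y.1 : ℝ) (y.1 + 1) ×ˢ Set.Ico (y.2 : ℝ) (y.2 + 1)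

lemma measurableSet_unitSquare (y : ℕ × ℕ) : MeasurableSet (unitSquare y) :=
  measurableSet_Ico.prod measurableSet_Ico

lemma volume_unitSquare (y : ℕ × ℕ) : MeasureTheory.volume (unitSquare y) = 1 := by
  rw [unitSquare, MeasureTheory.Measure.volume_eq_prod, MeasureTheory.Measure.prod_prod]
  simp

lemma mem_unitSquare_iff {y : ℕ × ℕ} {p : ℝ × ℝ} :
    p ∈ unitSquare y ↔ 0 ≤ p.1 ∧ 0 ≤ p.2 ∧ y = (⌊p.1⌋₊, ⌊p.2⌋₊) := by
  have key : ∀ (k : ℕ) (x : ℝ), x ∈ Set.Ico (k : ℝ) (k + 1) ↔ 0 ≤ x ∧ k = ⌊x⌋₊ := by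
    intro k x
    constructor
    · intro h
      have hx : 0 ≤ x := (Nat.cast_nonneg k).trans h.1
      exact ⟨hx, ((Nat.floor_eq_iff hx).2 h).symm⟩
    · rintro ⟨hx, h⟩
      exact (Nat.floor_eq_iff hx).1 h.symm
  rw [unitSquare, Set.mem_prod, key, key, Prod.ext_iff]
  tauto

lemma pairwise_disjoint_unitSquare : Pairwise (Function.onFun Disjoint unitSquare) := by
  intro y z hyz
  refine Set.disjoint_left.2 fun p hp hq => hyz ?_
  rw [mem_unitSquare_iff] at hp hq
  rw [hp.2.2, hq.2.2]

lemma iUnion_unitSquare : ⋃ y, unitSquare y = Set.Ici (0 : ℝ) ×ˢ Set.Ici (0 : ℝ) := by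
  ext p
  simp [mem_unitSquare_iff, Prod.le_def]

lemma lintegral_mul_exp_neg {s : ℝ} (hs : 0 < s) :
    ∫⁻ r in Set.Ioi (0 : ℝ), ENNReal.ofReal (r * exp (-s * r)) = ENNReal.ofReal (1 / s ^ 2) := by
  have h := Real.integral_rpow_mul_exp_neg_mul_Ioi (a := 2) (r := s) two_pos hs
  have h1 : ∫ t in Set.Ioi (0 : ℝ), t ^ ((2 : ℝ) - 1) * exp (-(s * t)) =
      ∫ t in Set.Ioi (0 : ℝ), t * exp (-s * t) := by
    norm_num
  have h2 : ∫ t in Set.Ioi (0 : ℝ), t * exp (-s * t) = 1 / s ^ 2 := by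
    rw [← h1, h]
    simp
  have hint : MeasureTheory.IntegrableOn (fun t : ℝ => t * exp (-s * t)) (Set.Ioi 0) := by
    by_contra hc
    rw [MeasureTheory.integral_undef hc] at h2
    have : 0 < 1 / s ^ 2 := by positivity
    linarith
  rw [← h2, MeasureTheory.ofReal_integral_eq_lintegral_ofReal hint]
  filter_upwards [MeasureTheory.ae_restrict_mem measurableSet_Ioi] with t ht
  have : (0 : ℝ) < t := ht
  positivity

lemma cos_nonneg_and_sin_nonneg_iff {t : ℝ} (h1 : -π < t) (h2 : t < π) :
    (0 ≤ cos t ∧ 0 ≤ sin t) ↔ t ∈ Set.Icc 0 (π / 2) := by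
  constructor
  · rintro ⟨hc, hs⟩
    have h0 : 0 ≤ t := by
      by_contra! h
      linarith [sin_neg_of_neg_of_neg_pi_lt h h1]
    refine ⟨h0, ?_⟩
    by_contra! h
    linarith [cos_neg_of_pi_div_two_lt_of_lt h (by linarith [pi_pos])]
  · rintro ⟨h3, h4⟩
    exact ⟨cos_nonneg_of_mem_Icc ⟨by linarith, h4⟩, sin_nonneg_of_nonneg_of_le_pi h3 h2.le⟩

lemma lintegral_quadrant_exp_neg {s : ℝ} (hs : 0 < s) :
    ∫⁻ p in Set.Ici (0 : ℝ) ×ˢ Set.Ici (0 : ℝ), ENNReal.ofReal (exp (-s * √(p.1 ^ 2 + p.2 ^ 2))) =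
      ENNReal.ofReal (π / 2 / s ^ 2) := by
  have hm : MeasurableSet (Set.Ici (0 : ℝ) ×ˢ Set.Ici (0 : ℝ)) :=
    measurableSet_Ici.prod measurableSet_Ici
  rw [← MeasureTheory.lintegral_indicator hm, ← lintegral_comp_polarCoord_symm]
  have h1 : ∀ p ∈ polarCoord.target, ENNReal.ofReal p.1 •
      (Set.Ici (0 : ℝ) ×ˢ Set.Ici (0 : ℝ)).indicator
        (fun p : ℝ × ℝ => ENNReal.ofReal (exp (-s * √(p.1 ^ 2 + p.2 ^ 2)))) (polarCoord.symm p) =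
      ENNReal.ofReal (p.1 * exp (-s * p.1)) *
        (Set.Icc 0 (π / 2)).indicator (fun _ => (1 : ENNReal)) p.2 := by
    rintro ⟨r, t⟩ ⟨hr, ht⟩
    simp only [Set.mem_Ioi] at hr
    have hiff := cos_nonneg_and_sin_nonneg_iff ht.1 ht.2
    have hsq : √((r * cos t) ^ 2 + (r * sin t) ^ 2) = r := by
      rw [mul_pow, mul_pow, ← mul_add, cos_sq_add_sin_sq, mul_one, sqrt_sq hr.le]
    by_cases h : t ∈ Set.Icc 0 (π / 2)
    · have h' := hiff.2 h
      rw [Set.indicator_of_mem, Set.indicator_of_mem h]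
      · simp only [polarCoord_symm_apply, hsq, smul_eq_mul, mul_one]
        rw [ENNReal.ofReal_mul hr.le]
      · simpa [polarCoord_symm_apply, hr] using h'
    · rw [Set.indicator_of_notMem, Set.indicator_of_notMem h]
      · simp
      · intro h'
        refine h (hiff.1 ?_)
        simpa [polarCoord_symm_apply, hr] using h'
  rw [MeasureTheory.setLIntegral_congr_fun polarCoord.open_target.measurableSet h1, polarCoord_target,
    MeasureTheory.Measure.volume_eq_prod, ← MeasureTheory.Measure.prod_restrict,
    MeasureTheory.lintegral_prod_mul (f := fun r : ℝ => ENNReal.ofReal (r * exp (-s * r)))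
      (by fun_prop) (Measurable.aemeasurable (measurable_const.indicator measurableSet_Icc)),
    lintegral_mul_exp_neg hs, MeasureTheory.lintegral_indicator measurableSet_Icc,
    MeasureTheory.Measure.restrict_restrict measurableSet_Icc]
  have : Set.Icc 0 (π / 2) ∩ Set.Ioo (-π) π = Set.Icc 0 (π / 2) :=
    Set.inter_eq_left.2 fun t ht => ⟨by linarith [ht.1, pi_pos], by linarith [ht.2, pi_pos]⟩
  rw [this]
  simp only [MeasureTheory.lintegral_const, MeasureTheory.Measure.restrict_apply MeasurableSet.univ,
    Set.univ_inter, Real.volume_Icc, one_mul, sub_zero]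
  rw [← ENNReal.ofReal_mul (by positivity)]
  congr 1
  ring

lemma lintegral_quadrant_eq_tsum {s : ℝ} (hs : 0 < s) :
    ∑' y, ∫⁻ p in unitSquare y, ENNReal.ofReal (exp (-s * √(p.1 ^ 2 + p.2 ^ 2))) =
      ENNReal.ofReal (π / 2 / s ^ 2) := by
  rw [← MeasureTheory.lintegral_iUnion measurableSet_unitSquare pairwise_disjoint_unitSquare,
    iUnion_unitSquare, lintegral_quadrant_exp_neg hs]

lemma latticeLen_le_of_mem_unitSquare {y : ℕ × ℕ} {p : ℝ × ℝ} (hp : p ∈ unitSquare y) :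
    latticeLen y ≤ √(p.1 ^ 2 + p.2 ^ 2) := by
  obtain ⟨⟨h1, -⟩, ⟨h2, -⟩⟩ := hp
  unfold latticeLen
  gcongr

lemma le_latticeLen_add_two_of_mem_unitSquare {y : ℕ × ℕ} {p : ℝ × ℝ} (hp : p ∈ unitSquare y) :
    √(p.1 ^ 2 + p.2 ^ 2) ≤ latticeLen y + 2 := by
  obtain ⟨⟨h1, h1'⟩, ⟨h2, h2'⟩⟩ := hp
  have e1 : (0 : ℝ) ≤ y.1 := Nat.cast_nonneg _
  have e2 : (0 : ℝ) ≤ y.2 := Nat.cast_nonneg _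
  have hl : latticeLen y ^ 2 = (y.1 : ℝ) ^ 2 + (y.2 : ℝ) ^ 2 := sq_sqrt (by positivity)
  have hl0 : 0 ≤ latticeLen y := sqrt_nonneg _
  have hy1 : (y.1 : ℝ) ≤ latticeLen y := abs_le_of_sq_le_sq' (by nlinarith) hl0 |>.2
  have hy2 : (y.2 : ℝ) ≤ latticeLen y := abs_le_of_sq_le_sq' (by nlinarith) hl0 |>.2
  rw [sqrt_le_left (by linarith)]
  nlinarith

lemma tsum_ofReal_exp_latticeLen_le {s : ℝ} (hs : 0 < s) :
    ∑' y, ENNReal.ofReal (exp (-s * latticeLen y)) ≤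
      ENNReal.ofReal (exp (2 * s) * (π / 2 / s ^ 2)) := by
  rw [ENNReal.ofReal_mul (exp_pos _).le, ← lintegral_quadrant_eq_tsum hs, ← ENNReal.tsum_mul_left]
  refine ENNReal.tsum_le_tsum fun y => ?_
  rw [← MeasureTheory.lintegral_const_mul' _ _ ENNReal.ofReal_ne_top]
  calc ENNReal.ofReal (exp (-s * latticeLen y))
      = ∫⁻ _ in unitSquare y, ENNReal.ofReal (exp (-s * latticeLen y)) := by
        simp [volume_unitSquare]
    _ ≤ _ := by
        refine MeasureTheory.setLIntegral_mono' (measurableSet_unitSquare y) fun p hp => ?_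
        rw [← ENNReal.ofReal_mul (exp_pos _).le, ← exp_add]
        refine ENNReal.ofReal_le_ofReal (exp_le_exp.2 ?_)
        nlinarith [le_latticeLen_add_two_of_mem_unitSquare hp]

lemma le_tsum_ofReal_exp_latticeLen {s : ℝ} (hs : 0 < s) :
    ENNReal.ofReal (π / 2 / s ^ 2) ≤ ∑' y, ENNReal.ofReal (exp (-s * latticeLen y)) := by
  rw [← lintegral_quadrant_eq_tsum hs]
  refine ENNReal.tsum_le_tsum fun y => ?_
  calc _ ≤ ∫⁻ _ in unitSquare y, ENNReal.ofReal (exp (-s * latticeLen y)) := by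
        refine MeasureTheory.setLIntegral_mono' (measurableSet_unitSquare y) fun p hp => ?_
        refine ENNReal.ofReal_le_ofReal (exp_le_exp.2 ?_)
        nlinarith [latticeLen_le_of_mem_unitSquare hp]
    _ = _ := by simp [volume_unitSquare]

lemma summable_exp_latticeLen {s : ℝ} (hs : 0 < s) :
    Summable fun y => exp (-s * latticeLen y) := by
  have h := ne_top_of_le_ne_top ENNReal.ofReal_ne_top (tsum_ofReal_exp_latticeLen_le hs)
  exact (ENNReal.summable_toReal h).congr fun y => ENNReal.toReal_ofReal (exp_pos _).le

lemma tsum_exp_latticeLen_le {s : ℝ} (hs : 0 < s) :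
    ∑' y, exp (-s * latticeLen y) ≤ exp (2 * s) * (π / 2 / s ^ 2) := by
  have h := tsum_ofReal_exp_latticeLen_le hs
  rwa [← ENNReal.ofReal_tsum_of_nonneg (fun _ => (exp_pos _).le) (summable_exp_latticeLen hs),
    ENNReal.ofReal_le_ofReal_iff (by positivity)] at h

lemma le_tsum_exp_latticeLen {s : ℝ} (hs : 0 < s) :
    π / 2 / s ^ 2 ≤ ∑' y, exp (-s * latticeLen y) := by
  have h := le_tsum_ofReal_exp_latticeLen hs
  rwa [← ENNReal.ofReal_tsum_of_nonneg (fun _ => (exp_pos _).le) (summable_exp_latticeLen hs),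
    ENNReal.ofReal_le_ofReal_iff (tsum_nonneg fun _ => (exp_pos _).le)] at h

/-- The weight `exp (-s |y|)` of a nonzero lattice vector `y`, extended by `0` at the origin. -/
noncomputable def puncturedExp (s : ℝ) (y : ℕ × ℕ) : ℝ :=
  if y = 0 then 0 else exp (-s * latticeLen y)

lemma puncturedExp_nonneg (s : ℝ) (y : ℕ × ℕ) : 0 ≤ puncturedExp s y := by
  unfold puncturedExp
  split_ifs
  · exact le_rfl
  · exact (exp_pos _).le

lemma puncturedExp_le (s : ℝ) (y : ℕ × ℕ) : puncturedExp s y ≤ exp (-s * latticeLen y) := by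
  unfold puncturedExp
  split_ifs
  · exact (exp_pos _).le
  · exact le_rfl

lemma summable_puncturedExp {s : ℝ} (hs : 0 < s) : Summable (puncturedExp s) :=
  (summable_exp_latticeLen hs).of_nonneg_of_le (puncturedExp_nonneg s) (puncturedExp_le s)

lemma latticeLen_zero : latticeLen 0 = 0 := by simp [latticeLen]

lemma one_le_latticeLen {y : ℕ × ℕ} (hy : y ≠ 0) : 1 ≤ latticeLen y := by
  refine one_le_sqrt.2 ?_
  have h : 1 ≤ y.1 ^ 2 + y.2 ^ 2 := by
    rw [Nat.one_le_iff_ne_zero]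
    intro h
    refine hy (Prod.ext ?_ ?_) <;> simp at h <;> simp [h]
  exact_mod_cast h

lemma tsum_puncturedExp {s : ℝ} (hs : 0 < s) :
    ∑' y, puncturedExp s y = ∑' y, exp (-s * latticeLen y) - 1 := by
  rw [(summable_exp_latticeLen hs).tsum_eq_add_tsum_ite 0]
  simp [latticeLen_zero, puncturedExp]

lemma tendsto_sq_mul_tsum_puncturedExp :
    Tendsto (fun s : ℝ => s ^ 2 * ∑' y, puncturedExp s y) (𝓝[>] 0) (𝓝 (π / 2)) := by
  have hid : Tendsto (fun s : ℝ => s) (𝓝[>] 0) (𝓝 0) := tendsto_nhdsWithin_of_tendsto_nhds tendsto_id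
  have h1 : Tendsto (fun s : ℝ => π / 2 - s ^ 2) (𝓝[>] 0) (𝓝 (π / 2)) := by
    simpa using tendsto_const_nhds.sub (hid.pow 2)
  have h2 : Tendsto (fun s : ℝ => exp (2 * s) * (π / 2)) (𝓝[>] 0) (𝓝 (π / 2)) := by
    simpa using ((continuous_exp.tendsto _).comp (hid.const_mul 2)).mul_const (π / 2)
  refine tendsto_of_tendsto_of_tendsto_of_le_of_le' h1 h2 ?_ ?_
  · filter_upwards [self_mem_nhdsWithin] with s hs
    have hs : 0 < s := hs
    rw [tsum_puncturedExp hs, mul_sub, mul_one]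
    have := mul_le_mul_of_nonneg_left (le_tsum_exp_latticeLen hs) (sq_nonneg s)
    rw [mul_div_cancel₀ _ (by positivity)] at this
    linarith
  · filter_upwards [self_mem_nhdsWithin] with s hs
    have hs : 0 < s := hs
    rw [tsum_puncturedExp hs, mul_sub, mul_one]
    have := mul_le_mul_of_nonneg_left (tsum_exp_latticeLen_le hs) (sq_nonneg s)
    have e : s ^ 2 * (exp (2 * s) * (π / 2 / s ^ 2)) = exp (2 * s) * (π / 2) := by
      field_simp
    nlinarith [sq_nonneg s]

lemma puncturedExp_le_mul {s : ℝ} (hs : 1 ≤ s) (y : ℕ × ℕ) :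
    puncturedExp s y ≤ exp (1 - s) * puncturedExp 1 y := by
  unfold puncturedExp
  split_ifs with hy
  · simp
  · rw [← exp_add]
    refine exp_le_exp.2 ?_
    nlinarith [one_le_latticeLen hy]

lemma exists_tsum_puncturedExp_le :
    ∃ K : ℝ, 0 < K ∧ ∀ s : ℝ, 0 < s → s ^ 2 * ∑' y, puncturedExp s y ≤ K := by
  have hF : ∀ s : ℝ, 0 < s → s ≤ 1 → s ^ 2 * ∑' y, puncturedExp s y ≤ exp 2 * (π / 2) := by
    intro s hs hs1
    have h1 : ∑' y, puncturedExp s y ≤ exp 2 * (π / 2 / s ^ 2) := by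
      rw [tsum_puncturedExp hs]
      have h2 : exp (2 * s) * (π / 2 / s ^ 2) ≤ exp 2 * (π / 2 / s ^ 2) := by
        gcongr
        linarith
      linarith [tsum_exp_latticeLen_le hs]
    calc _ ≤ s ^ 2 * (exp 2 * (π / 2 / s ^ 2)) := by gcongr
      _ = _ := by field_simp
  have h1 := hF 1 one_pos le_rfl
  rw [one_pow, one_mul] at h1
  have hexp1 : 1 ≤ exp 1 := one_le_exp zero_le_one
  have hK : 0 < exp 2 * (π / 2) := by positivity
  refine ⟨2 * exp 1 * (exp 2 * (π / 2)), by positivity, fun s hs => ?_⟩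
  rcases le_total s 1 with hs1 | hs1
  · refine (hF s hs hs1).trans ?_
    nlinarith
  · have h0 : 0 ≤ ∑' y, puncturedExp 1 y := tsum_nonneg (puncturedExp_nonneg 1)
    have h2 : ∑' y, puncturedExp s y ≤ exp (1 - s) * ∑' y, puncturedExp 1 y := by
      rw [← tsum_mul_left]
      exact (summable_puncturedExp hs).tsum_le_tsum (puncturedExp_le_mul hs1)
        ((summable_puncturedExp one_pos).mul_left _)
    have h3 : s ^ 2 * exp (1 - s) ≤ 2 * exp 1 := by
      rw [exp_sub, mul_div_assoc', div_le_iff₀ (exp_pos _)]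
      nlinarith [quadratic_le_exp_of_nonneg hs.le, exp_pos 1]
    calc _ ≤ s ^ 2 * (exp (1 - s) * ∑' y, puncturedExp 1 y) := by gcongr
      _ = (s ^ 2 * exp (1 - s)) * ∑' y, puncturedExp 1 y := by ring
      _ ≤ _ := by gcongr

/-- Dilation of a lattice vector by a natural number. -/
def dilate (d : ℕ) (y : ℕ × ℕ) : ℕ × ℕ := (d * y.1, d * y.2)

lemma latticeLen_dilate (d : ℕ) (y : ℕ × ℕ) : latticeLen (dilate d y) = d * latticeLen y := by
  unfold latticeLen dilate
  push_cast
  rw [mul_pow, mul_pow, ← mul_add, sqrt_mul (by positivity), sqrt_sq (by positivity)]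

lemma dilate_injective {d : ℕ} (hd : d ≠ 0) : Function.Injective (dilate d) := by
  rintro ⟨a, b⟩ ⟨a', b'⟩ h
  simpa [dilate, hd] using h

lemma puncturedExp_dilate {d : ℕ} (hd : d ≠ 0) (s : ℝ) (y : ℕ × ℕ) :
    puncturedExp s (dilate d y) = puncturedExp (d * s) y := by
  have h : dilate d y = 0 ↔ y = 0 := by
    simp [dilate, Prod.ext_iff, hd]
  unfold puncturedExp
  simp only [h, latticeLen_dilate]
  congr 2
  ring

lemma dvd_gcd_iff_mem_range_dilate {d : ℕ} {z : ℕ × ℕ} :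
    d ∣ Nat.gcd z.1 z.2 ↔ z ∈ Set.range (dilate d) := by
  constructor
  · intro h
    obtain ⟨a, ha⟩ := h.trans (Nat.gcd_dvd_left _ _)
    obtain ⟨b, hb⟩ := h.trans (Nat.gcd_dvd_right _ _)
    exact ⟨(a, b), Prod.ext ha.symm hb.symm⟩
  · rintro ⟨y, rfl⟩
    exact Nat.dvd_gcd (Dvd.intro _ rfl) (Dvd.intro _ rfl)

lemma tsum_multiples_puncturedExp {d : ℕ} (hd : d ≠ 0) (s : ℝ) :
    ∑' z : ℕ × ℕ, (if d ∣ Nat.gcd z.1 z.2 then puncturedExp s z else 0) =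
      ∑' y, puncturedExp (d * s) y := by
  rw [← (dilate_injective hd).tsum_eq]
  · refine tsum_congr fun y => ?_
    rw [if_pos (dvd_gcd_iff_mem_range_dilate.2 ⟨y, rfl⟩), puncturedExp_dilate hd]
  · intro z hz
    by_contra h
    rw [← dvd_gcd_iff_mem_range_dilate] at h
    simp [h] at hz

lemma sum_moebius_divisors (n : ℕ) :
    ∑ d ∈ n.divisors, (ArithmeticFunction.moebius d : ℝ) = if n = 1 then 1 else 0 := by
  have h := congrArg (fun f : ArithmeticFunction ℤ => f n) ArithmeticFunction.moebius_mul_coe_zeta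
  simp only [ArithmeticFunction.coe_mul_zeta_apply, ArithmeticFunction.one_apply] at h
  exact_mod_cast h

lemma abs_moebius_le_one_real (d : ℕ) : |(ArithmeticFunction.moebius d : ℝ)| ≤ 1 := by
  exact_mod_cast ArithmeticFunction.abs_moebius_le_one (n := d)

lemma summable_moebius_puncturedExp {s : ℝ} (hs : 0 < s) :
    Summable fun p : ℕ × (ℕ × ℕ) => (ArithmeticFunction.moebius p.1 : ℝ) *
      (if p.1 ∣ Nat.gcd p.2.1 p.2.2 then puncturedExp s p.2 else 0) := by
  have hnn : ∀ (d : ℕ) (z : ℕ × ℕ),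
      0 ≤ (if d ∣ Nat.gcd z.1 z.2 then puncturedExp s z else 0) := by
    intro d z
    split_ifs
    · exact puncturedExp_nonneg _ _
    · exact le_rfl
  have hsum : ∀ d : ℕ, Summable fun z : ℕ × ℕ =>
      (if d ∣ Nat.gcd z.1 z.2 then puncturedExp s z else 0) := by
    intro d
    refine (summable_puncturedExp hs).of_nonneg_of_le (hnn d) fun z => ?_
    split_ifs
    · exact le_rfl
    · exact puncturedExp_nonneg _ _
  obtain ⟨K, hK0, hK⟩ := exists_tsum_puncturedExp_le
  rw [← summable_abs_iff, summable_prod_of_nonneg fun _ => abs_nonneg _]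
  have habs : ∀ (d : ℕ) (z : ℕ × ℕ), |(ArithmeticFunction.moebius d : ℝ) *
      (if d ∣ Nat.gcd z.1 z.2 then puncturedExp s z else 0)| =
      |(ArithmeticFunction.moebius d : ℝ)| *
        (if d ∣ Nat.gcd z.1 z.2 then puncturedExp s z else 0) := by
    intro d z
    rw [abs_mul, abs_of_nonneg (hnn d z)]
  simp only [habs]
  refine ⟨fun d => (hsum d).mul_left _, ?_⟩
  refine Summable.of_nonneg_of_le (fun d => tsum_nonneg fun z => mul_nonneg (abs_nonneg _) (hnn d z))
    (fun d => ?_) ((Real.summable_one_div_nat_pow.2 one_lt_two).mul_left (K / s ^ 2))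
  rw [tsum_mul_left]
  rcases eq_or_ne d 0 with rfl | hd
  · simp
  · rw [tsum_multiples_puncturedExp hd]
    have hd' : (0 : ℝ) < d := by positivity
    have h := hK (d * s) (by positivity)
    have h0 : 0 ≤ ∑' y, puncturedExp (d * s) y := tsum_nonneg (puncturedExp_nonneg _)
    calc _ ≤ 1 * ∑' y, puncturedExp (d * s) y :=
          mul_le_mul_of_nonneg_right (abs_moebius_le_one_real d) h0
      _ ≤ K / (d * s) ^ 2 := by
          rw [one_mul, le_div_iff₀ (by positivity), mul_comm]
          exact h
      _ = K / s ^ 2 * (1 / (d : ℝ) ^ 2) := by field_simp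

lemma tsum_moebius_multiples (s : ℝ) (d : ℕ) :
    ∑' z : ℕ × ℕ, (ArithmeticFunction.moebius d : ℝ) *
        (if d ∣ Nat.gcd z.1 z.2 then puncturedExp s z else 0) =
      (ArithmeticFunction.moebius d : ℝ) * ∑' y, puncturedExp (d * s) y := by
  rw [tsum_mul_left]
  rcases eq_or_ne d 0 with rfl | hd
  · simp
  · rw [tsum_multiples_puncturedExp hd]

lemma tsum_moebius_dvd_gcd (s : ℝ) (z : ℕ × ℕ) :
    ∑' d : ℕ, (ArithmeticFunction.moebius d : ℝ) *
        (if d ∣ Nat.gcd z.1 z.2 then puncturedExp s z else 0) =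
      if Nat.gcd z.1 z.2 = 1 then puncturedExp s z else 0 := by
  rcases eq_or_ne z 0 with rfl | hz
  · simp [puncturedExp]
  · have hg : Nat.gcd z.1 z.2 ≠ 0 := by
      intro h
      rw [Nat.gcd_eq_zero_iff] at h
      exact hz (Prod.ext h.1 h.2)
    rw [tsum_eq_sum (s := (Nat.gcd z.1 z.2).divisors)]
    · have h3 : ∀ d ∈ (Nat.gcd z.1 z.2).divisors, (ArithmeticFunction.moebius d : ℝ) *
          (if d ∣ Nat.gcd z.1 z.2 then puncturedExp s z else 0) =
          (ArithmeticFunction.moebius d : ℝ) * puncturedExp s z := by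
        intro d hd
        rw [if_pos (Nat.dvd_of_mem_divisors hd)]
      rw [Finset.sum_congr rfl h3, ← Finset.sum_mul, sum_moebius_divisors, ite_mul, one_mul,
        zero_mul]
    · intro d hd
      rw [Nat.mem_divisors, not_and_or, not_not, or_iff_left hg] at hd
      rw [if_neg hd, mul_zero]

lemma ne_zero_of_primitive (x : Xc) : x.val ≠ 0 := by
  intro h
  have := x.2
  rw [h] at this
  simp at this

lemma tsum_primitive_eq_tsum_ite (s : ℝ) :
    ∑' x : Xc, exp (-s * latticeLen x.val) =
      ∑' z : ℕ × ℕ, if Nat.gcd z.1 z.2 = 1 then puncturedExp s z else 0 := by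
  rw [← Function.Injective.tsum_eq (Subtype.val_injective (p := fun x : ℕ × ℕ => Nat.gcd x.1 x.2 = 1))]
  · refine tsum_congr fun x => ?_
    rw [if_pos x.2, puncturedExp, if_neg (ne_zero_of_primitive x)]
  · intro z hz
    by_contra h
    simp only [Subtype.range_coe_subtype, Set.mem_ofPred_eq] at h
    simp [h] at hz

lemma tsum_moebius_mul_tsum_puncturedExp {s : ℝ} (hs : 0 < s) :
    ∑' d : ℕ, (ArithmeticFunction.moebius d : ℝ) * ∑' y, puncturedExp (d * s) y =
      ∑' x : Xc, exp (-s * latticeLen x.val) := by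
  rw [tsum_primitive_eq_tsum_ite, ← tsum_congr (tsum_moebius_multiples s),
    ← tsum_congr (tsum_moebius_dvd_gcd s)]
  symm
  apply Summable.tsum_comm
  convert! summable_moebius_puncturedExp hs using 1

lemma tsum_moebius_div_sq :
    ∑' d : ℕ, (ArithmeticFunction.moebius d : ℝ) * (1 / (d : ℝ) ^ 2) = 6 / π ^ 2 := by
  have hs : (1 : ℝ) < (2 : ℂ).re := by norm_num
  have h := ArithmeticFunction.LSeries_zeta_mul_Lseries_moebius hs
  rw [ArithmeticFunction.LSeries_zeta_eq_riemannZeta hs, riemannZeta_two] at h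
  have h1 : LSeries (fun n => (ArithmeticFunction.moebius n : ℂ)) 2 =
      ((∑' d : ℕ, (ArithmeticFunction.moebius d : ℝ) * (1 / (d : ℝ) ^ 2) : ℝ) : ℂ) := by
    rw [LSeries, Complex.ofReal_tsum]
    refine tsum_congr fun d => ?_
    rcases eq_or_ne d 0 with rfl | hd
    · simp
    · rw [LSeries.term_of_ne_zero hd]
      push_cast
      rw [Complex.cpow_ofNat]
      ring
  rw [h1] at h
  have h2 : π ^ 2 / 6 * ∑' d : ℕ, (ArithmeticFunction.moebius d : ℝ) * (1 / (d : ℝ) ^ 2) = 1 := by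
    exact_mod_cast h
  have := pi_pos
  field_simp at h2 ⊢
  linarith

/-- The sum of `exp (-s |x|)` over primitive lattice vectors `x` of the closed first quadrant. -/
noncomputable def primitiveSum (s : ℝ) : ℝ := ∑' x : Xc, exp (-s * latticeLen x.val)

lemma summable_primitive {s : ℝ} (hs : 0 < s) :
    Summable fun x : Xc => exp (-s * latticeLen x.val) :=
  (summable_exp_latticeLen hs).comp_injective Subtype.val_injective

lemma primitiveSum_nonneg (s : ℝ) : 0 ≤ primitiveSum s := tsum_nonneg fun _ => (exp_pos _).le

lemma primitiveSum_le {s : ℝ} (hs : 0 < s) : primitiveSum s ≤ ∑' y, puncturedExp s y := by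
  refine (summable_primitive hs).tsum_le_tsum_of_inj Subtype.val Subtype.val_injective
    (fun y _ => puncturedExp_nonneg s y) (fun x => ?_) (summable_puncturedExp hs)
  rw [puncturedExp, if_neg (ne_zero_of_primitive x)]

lemma exists_primitiveSum_le :
    ∃ K : ℝ, 0 < K ∧ ∀ s : ℝ, 0 < s → s ^ 2 * primitiveSum s ≤ K := by
  obtain ⟨K, hK0, hK⟩ := exists_tsum_puncturedExp_le
  exact ⟨K, hK0, fun s hs => (mul_le_mul_of_nonneg_left (primitiveSum_le hs) (sq_nonneg s)).trans
    (hK s hs)⟩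

lemma tendsto_const_mul_nhdsGT_zero {c : ℝ} (hc : 0 < c) :
    Tendsto (fun s : ℝ => c * s) (𝓝[>] 0) (𝓝[>] 0) := by
  refine tendsto_nhdsWithin_iff.2 ⟨?_, ?_⟩
  · simpa using tendsto_nhdsWithin_of_tendsto_nhds ((continuous_const_mul c).tendsto 0)
  · filter_upwards [self_mem_nhdsWithin] with s hs
    exact mul_pos hc hs

lemma tendsto_sq_mul_primitiveSum :
    Tendsto (fun s : ℝ => s ^ 2 * primitiveSum s) (𝓝[>] 0) (𝓝 (3 / π)) := by
  obtain ⟨K, hK0, hK⟩ := exists_tsum_puncturedExp_le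
  have hlim : Tendsto (fun s : ℝ => ∑' d : ℕ, (ArithmeticFunction.moebius d : ℝ) * (1 / (d : ℝ) ^ 2) *
      ((d * s) ^ 2 * ∑' y, puncturedExp (d * s) y)) (𝓝[>] 0)
      (𝓝 (∑' d : ℕ, (ArithmeticFunction.moebius d : ℝ) * (1 / (d : ℝ) ^ 2) * (π / 2))) := by
    refine tendsto_tsum_of_dominated_convergence
      ((Real.summable_one_div_nat_pow.2 one_lt_two).mul_right K) (fun d => ?_) ?_
    · rcases eq_or_ne d 0 with rfl | hd
      · simp
      · exact (tendsto_sq_mul_tsum_puncturedExp.comp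
          (tendsto_const_mul_nhdsGT_zero (c := (d : ℝ)) (by positivity))).const_mul _
    · filter_upwards [self_mem_nhdsWithin] with s hs d
      have hs : 0 < s := hs
      rcases eq_or_ne d 0 with rfl | hd
      · simp
      · have h0 : 0 ≤ ∑' y, puncturedExp (d * s) y := tsum_nonneg (puncturedExp_nonneg _)
        rw [norm_mul, norm_mul, Real.norm_eq_abs, Real.norm_of_nonneg (by positivity),
          Real.norm_of_nonneg (by positivity)]
        have := hK (d * s) (by positivity)
        have := abs_moebius_le_one_real d
        calc _ ≤ 1 * (1 / (d : ℝ) ^ 2) * K := by gcongr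
          _ = _ := by rw [one_mul]
  rw [tsum_mul_right, tsum_moebius_div_sq] at hlim
  have he : 6 / π ^ 2 * (π / 2) = 3 / π := by
    have := pi_pos
    field_simp
    norm_num
  rw [he] at hlim
  refine hlim.congr' ?_
  filter_upwards [self_mem_nhdsWithin] with s hs
  rw [primitiveSum, ← tsum_moebius_mul_tsum_puncturedExp hs, ← tsum_mul_left]
  refine tsum_congr fun d => ?_
  rcases eq_or_ne d 0 with rfl | hd
  · simp
  · field_simp

/-- The logarithm `∑ₓ -log (1 - exp (-s |x|))` of the partition function of the chains. -/
noncomputable def logPartition (s : ℝ) : ℝ := ∑' x : Xc, -log (1 - exp (-s * latticeLen x.val))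

lemma summable_inv_nat_succ_cube : Summable fun k : ℕ => 1 / ((k : ℝ) + 1) ^ 3 := by
  have h := (summable_nat_add_iff 1).2 (Real.summable_one_div_nat_pow (p := 3).2 (by norm_num))
  exact h.congr fun k => by push_cast; rfl

lemma hasSum_neg_log_primitive {s : ℝ} (hs : 0 < s) (x : Xc) :
    HasSum (fun k : ℕ => 1 / ((k : ℝ) + 1) * exp (-(((k : ℝ) + 1) * s) * latticeLen x.val))
      (-log (1 - exp (-s * latticeLen x.val))) := by
  have hlt : |exp (-s * latticeLen x.val)| < 1 := by
    rw [abs_of_pos (exp_pos _), exp_lt_one_iff]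
    nlinarith [one_le_latticeLen (ne_zero_of_primitive x)]
  refine (hasSum_pow_div_log_of_abs_lt_one hlt).congr_fun fun k => ?_
  rw [← exp_nat_mul, one_div_mul_eq_div]
  congr 2
  push_cast
  ring

lemma summable_primitive_powers {s : ℝ} (hs : 0 < s) :
    Summable fun p : ℕ × Xc =>
      1 / ((p.1 : ℝ) + 1) * exp (-(((p.1 : ℝ) + 1) * s) * latticeLen p.2.val) := by
  obtain ⟨K, hK0, hK⟩ := exists_primitiveSum_le
  have hfib : ∀ k : ℕ, ∑' x : Xc, 1 / ((k : ℝ) + 1) *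
      exp (-(((k : ℝ) + 1) * s) * latticeLen x.val) ≤ K / s ^ 2 * (1 / ((k : ℝ) + 1) ^ 3) := by
    intro k
    have h := hK ((k + 1) * s) (by positivity)
    rw [tsum_mul_left]
    calc _ ≤ 1 / ((k : ℝ) + 1) * (K / ((k + 1) * s) ^ 2) := by
          refine mul_le_mul_of_nonneg_left ?_ (by positivity)
          rw [le_div_iff₀ (by positivity), mul_comm]
          exact h
      _ = K / s ^ 2 * (1 / ((k : ℝ) + 1) ^ 3) := by field_simp
  refine (summable_prod_of_nonneg ?_).2 ⟨fun k => ?_, ?_⟩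
  · intro p
    simp only [Pi.zero_apply]
    positivity
  · dsimp only
    exact (summable_primitive (s := ((k : ℝ) + 1) * s) (by positivity)).mul_left _
  · refine Summable.of_nonneg_of_le (fun k => tsum_nonneg fun x => ?_) hfib
      (summable_inv_nat_succ_cube.mul_left (K / s ^ 2))
    positivity

lemma logPartition_eq_tsum {s : ℝ} (hs : 0 < s) :
    logPartition s = ∑' k : ℕ, 1 / ((k : ℝ) + 1) * primitiveSum ((k + 1) * s) := by
  have h1 : ∀ x : Xc, -log (1 - exp (-s * latticeLen x.val)) =
      ∑' k : ℕ, 1 / ((k : ℝ) + 1) * exp (-(((k : ℝ) + 1) * s) * latticeLen x.val) :=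
    fun x => (hasSum_neg_log_primitive hs x).tsum_eq.symm
  have h2 : ∀ k : ℕ, 1 / ((k : ℝ) + 1) * primitiveSum ((k + 1) * s) =
      ∑' x : Xc, 1 / ((k : ℝ) + 1) * exp (-(((k : ℝ) + 1) * s) * latticeLen x.val) :=
    fun k => tsum_mul_left.symm
  rw [logPartition, tsum_congr h1, tsum_congr h2]
  apply Summable.tsum_comm
  convert! summable_primitive_powers hs using 1

lemma summable_neg_log_primitive {s : ℝ} (hs : 0 < s) :
    Summable fun x : Xc => -log (1 - exp (-s * latticeLen x.val)) :=
  (summable_primitive_powers hs).prod_symm.prod.congr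
    fun x => (hasSum_neg_log_primitive hs x).tsum_eq

lemma tendsto_sq_mul_logPartition :
    Tendsto (fun s : ℝ => s ^ 2 * logPartition s) (𝓝[>] 0) (𝓝 (zeta3 * (3 / π))) := by
  obtain ⟨K, hK0, hK⟩ := exists_primitiveSum_le
  have hlim : Tendsto (fun s : ℝ => ∑' k : ℕ, 1 / ((k : ℝ) + 1) ^ 3 *
      (((k + 1) * s) ^ 2 * primitiveSum ((k + 1) * s))) (𝓝[>] 0)
      (𝓝 (∑' k : ℕ, 1 / ((k : ℝ) + 1) ^ 3 * (3 / π))) := by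
    refine tendsto_tsum_of_dominated_convergence
      (summable_inv_nat_succ_cube.mul_right K) (fun k => ?_) ?_
    · exact (tendsto_sq_mul_primitiveSum.comp
        (tendsto_const_mul_nhdsGT_zero (c := (k : ℝ) + 1) (by positivity))).const_mul _
    · filter_upwards [self_mem_nhdsWithin] with s hs k
      have hs : 0 < s := hs
      have h0 := primitiveSum_nonneg ((k + 1) * s)
      rw [Real.norm_of_nonneg (by positivity)]
      have := hK ((k + 1) * s) (by positivity)
      gcongr
  rw [tsum_mul_right] at hlim
  refine hlim.congr' ?_
  filter_upwards [self_mem_nhdsWithin] with s hs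
  rw [logPartition_eq_tsum hs, ← tsum_mul_left]
  refine tsum_congr fun k => ?_
  field_simp

/-- The Boltzmann weight of the step `x` at inverse temperature `s`. -/
noncomputable def stepWeight (s : ℝ) (x : Xc) : ℝ := exp (-s * latticeLen x.val)

lemma exp_totalLength_eq_prod (s : ℝ) {S : Finset Xc} {ν : Xc →₀ ℕ} (h : ν.support ⊆ S) :
    exp (-s * totalLength ν) = ∏ x ∈ S, stepWeight s x ^ ν x := by
  have h1 : totalLength ν = ∑ x ∈ S, (ν x : ℝ) * latticeLen x.val :=
    Finsupp.sum_of_support_subset ν h (fun x m => (m : ℝ) * latticeLen x.val) (by simp)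
  rw [h1, Finset.mul_sum, exp_sum]
  refine Finset.prod_congr rfl fun x _ => ?_
  rw [stepWeight, ← exp_nat_mul]
  congr 1
  ring

lemma sum_finsupp_exp_totalLength (s : ℝ) (S : Finset Xc) (M : ℕ) :
    ∑ ν ∈ S.finsupp fun _ => Finset.range M, exp (-s * totalLength ν) =
      ∏ x ∈ S, ∑ m ∈ Finset.range M, stepWeight s x ^ m := by
  classical
  rw [Finset.prod_sum, Finset.finsupp, Finset.sum_map]
  refine Finset.sum_congr (by congr!) fun f _ => ?_
  rw [exp_totalLength_eq_prod s (S := S)]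
  · rw [← Finset.prod_attach]
    refine Finset.prod_congr rfl fun x _ => ?_
    simp [Finsupp.indicator_apply]
  · exact Finsupp.support_indicator_subset S f

lemma stepWeight_pos (s : ℝ) (x : Xc) : 0 < stepWeight s x := exp_pos _

lemma stepWeight_lt_one {s : ℝ} (hs : 0 < s) (x : Xc) : stepWeight s x < 1 := by
  rw [stepWeight, exp_lt_one_iff]
  nlinarith [one_le_latticeLen (ne_zero_of_primitive x)]

lemma prod_inv_one_sub_stepWeight {s : ℝ} (hs : 0 < s) (S : Finset Xc) :
    ∏ x ∈ S, (1 - stepWeight s x)⁻¹ =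
      exp (∑ x ∈ S, -log (1 - exp (-s * latticeLen x.val))) := by
  rw [exp_sum]
  refine Finset.prod_congr rfl fun x _ => ?_
  have h := stepWeight_lt_one hs x
  rw [exp_neg, exp_log, stepWeight]
  rw [stepWeight] at h
  linarith

lemma hasSum_exp_totalLength {s : ℝ} (hs : 0 < s) :
    HasSum (fun ν : Xc →₀ ℕ => exp (-s * totalLength ν)) (exp (logPartition s)) := by
  classical
  refine hasSum_of_isLUB_of_nonneg _ (fun _ => (exp_pos _).le) ⟨?_, ?_⟩
  · rintro _ ⟨T, rfl⟩
    set S : Finset Xc := T.biUnion fun ν => ν.support with hS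
    set M : ℕ := T.sup fun ν => S.sup ν with hM
    have hsub : T ⊆ S.finsupp fun _ => Finset.range (M + 1) := by
      intro ν hν
      rw [Finset.mem_finsupp_iff]
      refine ⟨Finset.subset_biUnion_of_mem (fun ν : Xc →₀ ℕ => ν.support) hν, fun x hx => ?_⟩
      rw [Finset.mem_range, Nat.lt_succ_iff]
      exact (Finset.le_sup (f := ν) hx).trans
        (Finset.le_sup (f := fun ν : Xc →₀ ℕ => S.sup ν) hν)
    calc ∑ ν ∈ T, exp (-s * totalLength ν)
        ≤ ∑ ν ∈ S.finsupp fun _ => Finset.range (M + 1), exp (-s * totalLength ν) :=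
          Finset.sum_le_sum_of_subset_of_nonneg hsub fun _ _ _ => (exp_pos _).le
      _ = ∏ x ∈ S, ∑ m ∈ Finset.range (M + 1), stepWeight s x ^ m :=
          sum_finsupp_exp_totalLength s S _
      _ ≤ ∏ x ∈ S, (1 - stepWeight s x)⁻¹ := by
          refine Finset.prod_le_prod (fun x _ => Finset.sum_nonneg fun m _ =>
            pow_nonneg (stepWeight_pos s x).le m) fun x _ => ?_
          rw [← tsum_geometric_of_lt_one (stepWeight_pos s x).le (stepWeight_lt_one hs x)]
          exact (summable_geometric_of_lt_one (stepWeight_pos s x).le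
            (stepWeight_lt_one hs x)).sum_le_tsum _ fun m _ => pow_nonneg (stepWeight_pos s x).le m
      _ ≤ exp (logPartition s) := by
          rw [prod_inv_one_sub_stepWeight hs, exp_le_exp]
          refine (summable_neg_log_primitive hs).sum_le_tsum _ fun x _ => ?_
          have h1 := stepWeight_lt_one hs x
          have h2 := stepWeight_pos s x
          rw [stepWeight] at h1 h2
          exact neg_nonneg.2 (log_nonpos (by linarith) (by linarith))
  · intro b hb
    have h1 : ∀ S : Finset Xc, ∏ x ∈ S, (1 - stepWeight s x)⁻¹ ≤ b := by
      intro S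
      have hlim : Tendsto (fun M : ℕ => ∏ x ∈ S, ∑ m ∈ Finset.range M, stepWeight s x ^ m) atTop
          (𝓝 (∏ x ∈ S, (1 - stepWeight s x)⁻¹)) :=
        tendsto_finsetProd _ fun x _ => (hasSum_geometric_of_lt_one (stepWeight_pos s x).le
          (stepWeight_lt_one hs x)).tendsto_sum_nat
      refine le_of_tendsto' hlim fun M => ?_
      rw [← sum_finsupp_exp_totalLength]
      exact hb ⟨_, rfl⟩
    refine le_of_tendsto' ((continuous_exp.tendsto _).comp (summable_neg_log_primitive hs).hasSum)
      fun S => ?_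
    simpa only [Function.comp_def, ← prod_inv_one_sub_stepWeight hs] using h1 S

/-- The number of chains whose total length lies in `[a, b]`. -/
noncomputable def chainCount (a b : ℝ) : ℕ := Nat.card {ν : Xc →₀ ℕ // totalLength ν ∈ Set.Icc a b}

lemma finite_setOf_totalLength_le (b : ℝ) : {ν : Xc →₀ ℕ | totalLength ν ≤ b}.Finite := by
  have h := (hasSum_exp_totalLength one_pos).summable.tendsto_cofinite_zero.eventually_lt_const
    (exp_pos (-b))
  rw [eventually_cofinite] at h
  refine h.subset fun ν hν => ?_
  have hν : totalLength ν ≤ b := hν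
  simp only [Set.mem_ofPred_eq, exp_lt_exp]
  linarith

lemma finite_setOf_totalLength_mem_Icc (a b : ℝ) :
    {ν : Xc →₀ ℕ | totalLength ν ∈ Set.Icc a b}.Finite :=
  (finite_setOf_totalLength_le b).subset fun _ h => h.2

lemma chainCount_eq_card_toFinset (a b : ℝ) :
    chainCount a b = (finite_setOf_totalLength_mem_Icc a b).toFinset.card :=
  Set.ncard_eq_toFinset_card _ _

lemma chainCount_mul_exp_le {s : ℝ} (hs : 0 < s) (a b : ℝ) :
    chainCount a b * exp (-s * b) ≤ exp (logPartition s) := by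
  have hsum := hasSum_exp_totalLength hs
  rw [chainCount_eq_card_toFinset, ← nsmul_eq_mul]
  calc _ ≤ ∑ ν ∈ (finite_setOf_totalLength_mem_Icc a b).toFinset, exp (-s * totalLength ν) := by
        refine Finset.card_nsmul_le_sum _ _ _ fun ν hν => exp_le_exp.2 ?_
        have h : totalLength ν ∈ Set.Icc a b := by simpa using hν
        nlinarith [h.2]
    _ ≤ _ := sum_le_hasSum _ (fun _ _ => (exp_pos _).le) hsum

lemma logPartition_nonneg {s : ℝ} (hs : 0 < s) : 0 ≤ logPartition s := by
  rw [logPartition_eq_tsum hs]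
  exact tsum_nonneg fun k => mul_nonneg (by positivity) (primitiveSum_nonneg _)

lemma log_chainCount_le {s : ℝ} (hs : 0 < s) (a : ℝ) {b : ℝ} (hb : 0 ≤ b) :
    log (chainCount a b) ≤ s * b + logPartition s := by
  rcases Nat.eq_zero_or_pos (chainCount a b) with h | h
  · have := logPartition_nonneg hs
    rw [h, Nat.cast_zero, log_zero]
    positivity
  · rw [log_le_iff_le_exp (by exact_mod_cast h), exp_add]
    have h1 := chainCount_mul_exp_le hs a b
    rw [neg_mul, exp_neg, ← div_eq_mul_inv, div_le_iff₀ (exp_pos _)] at h1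
    linarith

lemma le_log_chainCount {s t u a b : ℝ} (hs : 0 < s) (hst : s ≤ t) (hu : 0 < u) (hus : u ≤ s)
    (ha : exp ((t - s) * a + logPartition t) ≤ exp (logPartition s) / 4)
    (hb : exp ((u - s) * b + logPartition u) ≤ exp (logPartition s) / 4) :
    0 < chainCount a b ∧ s * a + logPartition s - log 2 ≤ log (chainCount a b) := by
  classical
  set F := (finite_setOf_totalLength_mem_Icc a b).toFinset with hF
  have hmem : ∀ ν, ν ∈ F ↔ totalLength ν ∈ Set.Icc a b := fun ν => by simp [hF]
  have hsum := hasSum_exp_totalLength hs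
  have hF1 : HasSum (fun ν => if ν ∈ F then exp (-s * totalLength ν) else 0)
      (∑ ν ∈ F, exp (-s * totalLength ν)) := by
    have h := hasSum_sum_of_ne_finset_zero (s := F) (L := SummationFilter.unconditional _)
      (f := fun ν : Xc →₀ ℕ => if ν ∈ F then exp (-s * totalLength ν) else 0)
      (fun ν hν => if_neg hν)
    rwa [Finset.sum_congr rfl fun ν hν => if_pos hν] at h
  have hF2 := (hasSum_exp_totalLength (hs.trans_le hst)).mul_left (exp ((t - s) * a))
  have hF3 := (hasSum_exp_totalLength hu).mul_left (exp ((u - s) * b))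
  have hpt : ∀ ν : Xc →₀ ℕ, exp (-s * totalLength ν) ≤
      (if ν ∈ F then exp (-s * totalLength ν) else 0) +
        exp ((t - s) * a) * exp (-t * totalLength ν) +
        exp ((u - s) * b) * exp (-u * totalLength ν) := by
    intro ν
    have h2 : 0 < exp ((t - s) * a) * exp (-t * totalLength ν) := by positivity
    have h3 : 0 < exp ((u - s) * b) * exp (-u * totalLength ν) := by positivity
    by_cases hν : ν ∈ F
    · simp only [if_pos hν]
      linarith
    · simp only [if_neg hν, zero_add]
      rw [hmem, Set.mem_Icc, not_and_or, not_le, not_le] at hν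
      rcases hν with hν | hν
      · have : exp (-s * totalLength ν) ≤ exp ((t - s) * a) * exp (-t * totalLength ν) := by
          rw [← exp_add, exp_le_exp]
          nlinarith
        linarith
      · have : exp (-s * totalLength ν) ≤ exp ((u - s) * b) * exp (-u * totalLength ν) := by
          rw [← exp_add, exp_le_exp]
          nlinarith
        linarith
  have hle := hasSum_le hpt hsum ((hF1.add hF2).add hF3)
  rw [← exp_add, ← exp_add] at hle
  have hcard : ∑ ν ∈ F, exp (-s * totalLength ν) ≤ F.card • exp (-s * a) := by
    refine Finset.sum_le_card_nsmul _ _ _ fun ν hν => exp_le_exp.2 ?_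
    nlinarith [((hmem ν).1 hν).1]
  rw [nsmul_eq_mul, hF, ← chainCount_eq_card_toFinset] at hcard
  have hhalf : exp (logPartition s) / 2 ≤ chainCount a b * exp (-s * a) := by linarith
  have hpos : 0 < chainCount a b := by
    rw [Nat.pos_iff_ne_zero]
    intro h0
    rw [h0, Nat.cast_zero, zero_mul] at hhalf
    linarith [exp_pos (logPartition s)]
  refine ⟨hpos, ?_⟩
  rw [le_log_iff_exp_le (by exact_mod_cast hpos), exp_sub, exp_add, exp_log two_pos]
  rw [neg_mul, exp_neg, ← div_eq_mul_inv, le_div_iff₀ (exp_pos _)] at hhalf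
  linarith

lemma totalLength_add (ν μ : Xc →₀ ℕ) : totalLength (ν + μ) = totalLength ν + totalLength μ :=
  Finsupp.sum_add_index' (by simp) (by intros; push_cast; ring)

lemma totalLength_single (x : Xc) (m : ℕ) :
    totalLength (Finsupp.single x m) = m * latticeLen x.val :=
  Finsupp.sum_single_index (by simp)

lemma totalLength_nonneg (ν : Xc →₀ ℕ) : 0 ≤ totalLength ν :=
  Finset.sum_nonneg fun _ _ => by positivity

lemma exists_int_combination_sqrt_two_mem_Ioo {δ : ℝ} (hδ : 0 < δ) :
    ∃ p q : ℤ, (p : ℝ) + q * √2 ∈ Set.Ioo 0 δ := by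
  have hd : Dense (AddSubgroup.closure {√2, 1} : Set ℝ) :=
    dense_addSubgroupClosure_pair_iff.2 (by simpa using irrational_sqrt_two)
  obtain ⟨t, ht, ht'⟩ := hd.exists_between hδ
  obtain ⟨q, p, h⟩ := AddSubgroup.mem_closure_pair.1 ht
  refine ⟨p, q, ?_⟩
  rw [← h] at ht'
  simpa [add_comm] using ht'

lemma exists_nat_combination_sqrt_two {δ : ℝ} (hδ : 0 < δ) :
    ∃ R : ℝ, ∀ r : ℝ, R ≤ r → ∃ m k : ℕ, r ≤ m + k * √2 ∧ (m : ℝ) + k * √2 ≤ r + δ := by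
  obtain ⟨p, q, h0, h1⟩ := exists_int_combination_sqrt_two_mem_Ioo hδ
  set t : ℝ := p + q * √2 with ht
  set J : ℕ := ⌈1 / t⌉₊ with hJ
  refine ⟨J * |p| + J * |q| * √2, fun r hr => ?_⟩
  set B : ℝ := J * |p| + J * |q| * √2 with hB
  set N : ℕ := ⌊r - B⌋₊ with hN
  have hN1 : (N : ℝ) ≤ r - B := Nat.floor_le (by linarith)
  have hN2 : r - B < N + 1 := Nat.lt_floor_add_one _
  set j : ℕ := ⌈(r - B - N) / t⌉₊ with hj
  have hj1 : (r - B - N) / t ≤ j := Nat.le_ceil _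
  have hj2 : (j : ℝ) < (r - B - N) / t + 1 := Nat.ceil_lt_add_one (by
    apply div_nonneg _ h0.le
    linarith)
  have hjJ : j ≤ J := Nat.ceil_mono (by gcongr; linarith)
  rw [div_le_iff₀ h0] at hj1
  have hj3 : j * t < (r - B - N) + t := by
    have := mul_lt_mul_of_pos_right hj2 h0
    rwa [add_mul, one_mul, div_mul_cancel₀ _ h0.ne'] at this
  have hcoef : ∀ z : ℤ, 0 ≤ J * |z| + j * z := by
    intro z
    have h2 : (j : ℤ) * -z ≤ j * |z| := by
      gcongr
      exact neg_le_abs z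
    have h3 : (j : ℤ) * |z| ≤ J * |z| := by gcongr
    linarith
  obtain ⟨m, hm⟩ := Int.eq_ofNat_of_zero_le (hcoef p)
  obtain ⟨k, hk⟩ := Int.eq_ofNat_of_zero_le (hcoef q)
  have hm' : (J : ℝ) * |(p : ℝ)| + j * p = m := by exact_mod_cast hm
  have hk' : (J : ℝ) * |(q : ℝ)| + j * q = k := by exact_mod_cast hk
  have hval : ((N + m : ℕ) : ℝ) + k * √2 = N + B + j * t := by
    rw [hB, ht]
    push_cast
    rw [← hm', ← hk']
    ring
  refine ⟨N + m, k, ?_, ?_⟩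
  · rw [hval]
    linarith
  · rw [hval]
    linarith

/-- The horizontal unit step. -/
def horizontalStep : Xc := ⟨(1, 0), by norm_num⟩

/-- The diagonal step. -/
def diagonalStep : Xc := ⟨(1, 1), by norm_num⟩

lemma latticeLen_horizontalStep : latticeLen horizontalStep.val = 1 := by
  simp [latticeLen, horizontalStep]

lemma latticeLen_diagonalStep : latticeLen diagonalStep.val = √2 := by
  norm_num [latticeLen, diagonalStep]

lemma exists_chainCount_le_mul {δ : ℝ} (hδ : 0 < δ) :
    ∃ R : ℝ, ∀ a b n : ℝ, 0 ≤ n → b ≤ n - R →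
      chainCount a b ≤ (⌊n + δ⌋₊ + 1) ^ 2 * chainCount n (n + δ) := by
  obtain ⟨R, hR⟩ := exists_nat_combination_sqrt_two hδ
  refine ⟨R, fun a b n hn hb => ?_⟩
  have key : ∀ ν : {ν : Xc →₀ ℕ // totalLength ν ∈ Set.Icc a b}, ∃ m k : Fin (⌊n + δ⌋₊ + 1),
      totalLength (ν.val + (Finsupp.single horizontalStep m.val +
        Finsupp.single diagonalStep k.val)) ∈ Set.Icc n (n + δ) := by
    rintro ⟨ν, hν⟩
    obtain ⟨m, k, h1, h2⟩ := hR (n - totalLength ν) (by linarith [hν.2])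
    have h0 := totalLength_nonneg ν
    have hs2 : 1 ≤ √2 := one_le_sqrt.2 one_le_two
    have hm0 : (0 : ℝ) ≤ m := m.cast_nonneg
    have hk0 : (0 : ℝ) ≤ k := k.cast_nonneg
    have hm : m < ⌊n + δ⌋₊ + 1 := Nat.lt_succ_iff.2 (Nat.le_floor (by nlinarith))
    have hk : k < ⌊n + δ⌋₊ + 1 := Nat.lt_succ_iff.2 (Nat.le_floor (by nlinarith))
    refine ⟨⟨m, hm⟩, ⟨k, hk⟩, ?_⟩
    simp only [totalLength_add, totalLength_single, latticeLen_horizontalStep,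
      latticeLen_diagonalStep, mul_one]
    constructor <;> linarith
  choose m k hmk using key
  have hfin : Finite {ν : Xc →₀ ℕ // totalLength ν ∈ Set.Icc n (n + δ)} :=
    (finite_setOf_totalLength_mem_Icc n (n + δ)).to_subtype
  have h := Nat.card_le_card_of_injective
    (fun ν : {ν : Xc →₀ ℕ // totalLength ν ∈ Set.Icc a b} =>
      ((m ν, k ν), (⟨_, hmk ν⟩ : {ν : Xc →₀ ℕ // totalLength ν ∈ Set.Icc n (n + δ)}))) (by
      intro ν μ h
      simp only [Prod.mk.injEq, Subtype.mk.injEq] at h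
      obtain ⟨⟨h1, h2⟩, h3⟩ := h
      rw [h1, h2] at h3
      exact Subtype.ext (add_right_cancel h3))
  rwa [Nat.card_prod, Nat.card_prod, Nat.card_fin, ← sq] at h

lemma eventually_tilt_le {C τ a : ℝ}
    (hC : Tendsto (fun s : ℝ => s ^ 2 * logPartition s) (𝓝[>] 0) (𝓝 C)) (hτ : 0 < τ)
    (h : (τ - 1) * a + C / τ ^ 2 - C < 0) :
    ∀ᶠ s : ℝ in 𝓝[>] 0, exp ((τ * s - s) * (a / s ^ 3) + logPartition (τ * s)) ≤
      exp (logPartition s) / 4 := by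
  have hid : Tendsto (fun s : ℝ => s) (𝓝[>] 0) (𝓝 0) := tendsto_nhdsWithin_of_tendsto_nhds tendsto_id
  have h1 : Tendsto (fun s : ℝ => (τ - 1) * a + ((τ * s) ^ 2 * logPartition (τ * s)) / τ ^ 2 -
      s ^ 2 * logPartition s + s ^ 2 * log 4) (𝓝[>] 0)
      (𝓝 ((τ - 1) * a + C / τ ^ 2 - C + 0 ^ 2 * log 4)) :=
    ((((hC.comp (tendsto_const_mul_nhdsGT_zero hτ)).div_const (τ ^ 2)).const_add ((τ - 1) * a)).sub
      hC).add ((hid.pow 2).mul_const (log 4))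
  have h2 := h1.eventually_lt_const (u := 0) (by simpa using h)
  filter_upwards [h2, self_mem_nhdsWithin] with s hs hs0
  have hs0 : 0 < s := hs0
  rw [le_div_iff₀ four_pos, ← exp_log four_pos, ← exp_add, exp_le_exp]
  have h3 : s ^ 2 * ((τ * s - s) * (a / s ^ 3) + logPartition (τ * s) + log 4 - logPartition s) < 0 := by
    refine lt_of_eq_of_lt ?_ hs
    field_simp
    ring
  have h4 := neg_of_mul_neg_right h3 (sq_nonneg s)
  linarith

lemma exists_tilt_gt_one {C a : ℝ} (ha : a < 2 * C) :
    ∃ τ : ℝ, 1 < τ ∧ (τ - 1) * a + C / τ ^ 2 - C < 0 := by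
  have hcont : Tendsto (fun τ : ℝ => a * τ ^ 2 - C * (1 + τ)) (𝓝[>] 1) (𝓝 (a * 1 ^ 2 - C * (1 + 1))) :=
    tendsto_nhdsWithin_of_tendsto_nhds (Continuous.tendsto (by fun_prop) 1)
  obtain ⟨τ, h1, h2⟩ := ((hcont.eventually_lt_const (u := 0) (by linarith)).and
    self_mem_nhdsWithin).exists
  have h2 : 1 < τ := h2
  refine ⟨τ, h2, ?_⟩
  have h3 : (τ - 1) * a + C / τ ^ 2 - C = (τ - 1) * (a * τ ^ 2 - C * (1 + τ)) / τ ^ 2 := by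
    have : τ ≠ 0 := by linarith
    field_simp
    ring
  rw [h3]
  exact div_neg_of_neg_of_pos (mul_neg_of_pos_of_neg (by linarith) h1) (by positivity)

lemma exists_tilt_lt_one {C b : ℝ} (hb : 2 * C < b) :
    ∃ τ : ℝ, 0 < τ ∧ τ < 1 ∧ (τ - 1) * b + C / τ ^ 2 - C < 0 := by
  have hcont : Tendsto (fun τ : ℝ => b * τ ^ 2 - C * (1 + τ)) (𝓝[<] 1) (𝓝 (b * 1 ^ 2 - C * (1 + 1))) :=
    tendsto_nhdsWithin_of_tendsto_nhds (Continuous.tendsto (by fun_prop) 1)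
  obtain ⟨τ, h1, h2⟩ := ((hcont.eventually_const_lt (u := 0) (by linarith)).and
    (Ioo_mem_nhdsLT (show (0 : ℝ) < 1 from one_pos))).exists
  obtain ⟨h0, h2⟩ := h2
  refine ⟨τ, h0, h2, ?_⟩
  have h3 : (τ - 1) * b + C / τ ^ 2 - C = (τ - 1) * (b * τ ^ 2 - C * (1 + τ)) / τ ^ 2 := by
    field_simp
    ring
  rw [h3]
  exact div_neg_of_neg_of_pos (mul_neg_of_neg_of_pos (by linarith) h1) (by positivity)

lemma eventually_le_log_chainCount {C a b : ℝ}
    (hC : Tendsto (fun s : ℝ => s ^ 2 * logPartition s) (𝓝[>] 0) (𝓝 C))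
    (ha : a < 2 * C) (hb : 2 * C < b) :
    ∀ᶠ s : ℝ in 𝓝[>] 0, 0 < chainCount (a / s ^ 3) (b / s ^ 3) ∧
      a / s ^ 2 + logPartition s - log 2 ≤ log (chainCount (a / s ^ 3) (b / s ^ 3)) := by
  obtain ⟨t, ht1, ht⟩ := exists_tilt_gt_one ha
  obtain ⟨u, hu0, hu1, hu⟩ := exists_tilt_lt_one hb
  filter_upwards [eventually_tilt_le hC (by linarith) ht, eventually_tilt_le hC hu0 hu,
    self_mem_nhdsWithin] with s h1 h2 hs
  have hs : 0 < s := hs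
  have h := le_log_chainCount hs (by nlinarith) (mul_pos hu0 hs) (by nlinarith) h1 h2
  have he : s * (a / s ^ 3) = a / s ^ 2 := by field_simp
  rwa [he] at h

lemma tendsto_natCast_rpow_third : Tendsto (fun n : ℕ => (n : ℝ) ^ ((1 : ℝ) / 3)) atTop atTop :=
  (tendsto_rpow_atTop (by norm_num)).comp tendsto_natCast_atTop_atTop

lemma rpow_third_pow_three (x : ℝ) (hx : 0 ≤ x) : (x ^ ((1 : ℝ) / 3)) ^ 3 = x := by
  rw [← rpow_natCast, ← rpow_mul hx]
  norm_num

lemma rpow_third_sq (x : ℝ) (hx : 0 ≤ x) : (x ^ ((1 : ℝ) / 3)) ^ 2 = x ^ ((2 : ℝ) / 3) := by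
  rw [← rpow_natCast, ← rpow_mul hx]
  norm_num

lemma tendsto_div_rpow_third {l : ℝ} (hl : 0 < l) :
    Tendsto (fun n : ℕ => l / (n : ℝ) ^ ((1 : ℝ) / 3)) atTop (𝓝[>] 0) := by
  refine tendsto_nhdsWithin_iff.2 ⟨tendsto_natCast_rpow_third.const_div_atTop l, ?_⟩
  filter_upwards [tendsto_natCast_rpow_third.eventually_gt_atTop 0] with n hn
  exact div_pos hl hn

lemma tendsto_log_natFloor_div {δ : ℝ} (hδ : 0 < δ) :
    Tendsto (fun n : ℕ => log (⌊(n : ℝ) + δ⌋₊ + 1) / (n : ℝ) ^ ((2 : ℝ) / 3)) atTop (𝓝 0) := by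
  have h1 : Tendsto (fun n : ℕ => log n / (n : ℝ) ^ ((2 : ℝ) / 3)) atTop (𝓝 0) :=
    (isLittleO_log_rpow_atTop (by norm_num)).tendsto_div_nhds_zero.comp tendsto_natCast_atTop_atTop
  have h2 : Tendsto (fun n : ℕ => log (δ + 2) / (n : ℝ) ^ ((2 : ℝ) / 3)) atTop (𝓝 0) :=
    ((tendsto_rpow_atTop (by norm_num)).comp tendsto_natCast_atTop_atTop).const_div_atTop _
  have h3 := h1.add h2
  rw [add_zero] at h3
  refine squeeze_zero' (Eventually.of_forall fun n => ?_) ?_ h3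
  · exact div_nonneg (log_nonneg (by simp)) (by positivity)
  · filter_upwards [eventually_ge_atTop 1] with n hn
    have hn1 : (1 : ℝ) ≤ n := by exact_mod_cast hn
    rw [← add_div, ← log_mul (by positivity) (by positivity)]
    have hf : (⌊(n : ℝ) + δ⌋₊ : ℝ) ≤ n + δ := Nat.floor_le (by positivity)
    gcongr
    nlinarith

lemma eventually_log_chainCount_div_lt {C c δ l : ℝ} (hδ : 0 < δ) (hl : 0 < l)
    (hC : Tendsto (fun s : ℝ => s ^ 2 * logPartition s) (𝓝[>] 0) (𝓝 C)) (hc : l + C / l ^ 2 < c) :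
    ∀ᶠ n : ℕ in atTop, log (chainCount n (n + δ)) / (n : ℝ) ^ ((2 : ℝ) / 3) < c := by
  have h1 := (hC.comp (tendsto_div_rpow_third hl)).div_const (l ^ 2)
  have h2 : Tendsto (fun n : ℕ => l + l * δ / n) atTop (𝓝 (l + 0)) :=
    (tendsto_natCast_atTop_atTop.const_div_atTop _).const_add l
  have h3 := (h2.add h1).eventually_lt_const (by simpa using hc)
  filter_upwards [h3, eventually_ge_atTop 1] with n hn hn1
  refine lt_of_le_of_lt ?_ hn
  have hn0 : (0 : ℝ) < n := by exact_mod_cast hn1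
  set y : ℝ := (n : ℝ) ^ ((1 : ℝ) / 3) with hy
  have hy0 : 0 < y := by positivity
  have hy3 : y ^ 3 = n := rpow_third_pow_three _ hn0.le
  rw [← rpow_third_sq _ hn0.le, ← hy, div_le_iff₀ (by positivity)]
  refine (log_chainCount_le (s := l / y) (by positivity) _ (by positivity)).trans_eq ?_
  simp only [Function.comp_apply, ← hy]
  rw [← hy3]
  field_simp

lemma eventually_lt_log_chainCount_div {C c a b δ l : ℝ} (hδ : 0 < δ) (hl : 0 < l)
    (hC : Tendsto (fun s : ℝ => s ^ 2 * logPartition s) (𝓝[>] 0) (𝓝 C))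
    (ha : a < 2 * C) (hb : 2 * C < b) (hbl : b < l ^ 3) (hc : c < (a + C) / l ^ 2) :
    ∀ᶠ n : ℕ in atTop, c < log (chainCount n (n + δ)) / (n : ℝ) ^ ((2 : ℝ) / 3) := by
  obtain ⟨R, hR⟩ := exists_chainCount_le_mul hδ
  have h1 := (hC.comp (tendsto_div_rpow_third hl)).div_const (l ^ 2)
  have h2 : Tendsto (fun n : ℕ => log 2 / (n : ℝ) ^ ((2 : ℝ) / 3)) atTop (𝓝 0) :=
    ((tendsto_rpow_atTop (by norm_num)).comp tendsto_natCast_atTop_atTop).const_div_atTop _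
  have h3 := (((h1.const_add (a / l ^ 2)).sub h2).sub
    ((tendsto_log_natFloor_div hδ).const_mul 2)).eventually_const_lt (u := c)
      (by rw [← add_div]; simpa using hc)
  have hbl' : 0 < 1 - b / l ^ 3 := by
    rw [sub_pos, div_lt_one (by positivity)]
    exact hbl
  have h4 : ∀ᶠ n : ℕ in atTop, R ≤ (1 - b / l ^ 3) * n :=
    (tendsto_natCast_atTop_atTop.const_mul_atTop hbl').eventually_ge_atTop R
  filter_upwards [h3, h4, (tendsto_div_rpow_third hl).eventually (eventually_le_log_chainCount hC ha hb),
    eventually_ge_atTop 1] with n hn hRn hcount hn1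
  refine lt_of_lt_of_le hn ?_
  have hn0 : (0 : ℝ) < n := by exact_mod_cast hn1
  set y : ℝ := (n : ℝ) ^ ((1 : ℝ) / 3) with hy
  have hy0 : 0 < y := by positivity
  have hy3 : y ^ 3 = n := rpow_third_pow_three _ hn0.le
  obtain ⟨hpos, hlog⟩ := hcount
  have hle := hR (a / (l / y) ^ 3) (b / (l / y) ^ 3) n hn0.le (by
    have : b / (l / y) ^ 3 = b / l ^ 3 * n := by
      rw [← hy3]
      field_simp
    rw [this]
    linarith)
  have hpos' : 0 < chainCount n (n + δ) := by
    rw [Nat.pos_iff_ne_zero]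
    intro h0
    rw [h0, mul_zero] at hle
    omega
  have hpos1 : (0 : ℝ) < chainCount n (n + δ) := by exact_mod_cast hpos'
  have hlog2 : log (chainCount (a / (l / y) ^ 3) (b / (l / y) ^ 3)) ≤
      2 * log (⌊(n : ℝ) + δ⌋₊ + 1) + log (chainCount n (n + δ)) := by
    have h5 : (chainCount (a / (l / y) ^ 3) (b / (l / y) ^ 3) : ℝ) ≤
        ((⌊(n : ℝ) + δ⌋₊ : ℝ) + 1) ^ 2 * chainCount n (n + δ) := by exact_mod_cast hle
    have h6 := log_le_log (by exact_mod_cast hpos) h5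
    rwa [log_mul (by positivity) hpos1.ne', log_pow, Nat.cast_ofNat] at h6
  have h7 : a / (l / y) ^ 2 + logPartition (l / y) - log 2 - 2 * log (⌊(n : ℝ) + δ⌋₊ + 1) ≤
      log (chainCount n (n + δ)) := by linarith
  rw [← rpow_third_sq _ hn0.le, ← hy, le_div_iff₀ (by positivity)]
  refine le_of_eq_of_le ?_ h7
  simp only [Function.comp_apply, ← hy]
  field_simp

lemma tendsto_log_chainCount_div {C δ l : ℝ} (hδ : 0 < δ) (hl : 0 < l) (hlC : l ^ 3 = 2 * C)
    (hC : Tendsto (fun s : ℝ => s ^ 2 * logPartition s) (𝓝[>] 0) (𝓝 C)) :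
    Tendsto (fun n : ℕ => log (chainCount n (n + δ)) / (n : ℝ) ^ ((2 : ℝ) / 3)) atTop
      (𝓝 (3 / 2 * l)) := by
  have hCl : C = l ^ 3 / 2 := by linarith
  refine tendsto_order.2 ⟨fun c hc => ?_, fun c hc => ?_⟩
  · have hcont : Tendsto (fun t : ℝ => (2 * C - t + C) / (l + t) ^ 2) (𝓝[>] 0)
        (𝓝 ((2 * C - 0 + C) / (l + 0) ^ 2)) := by
      refine tendsto_nhdsWithin_of_tendsto_nhds (ContinuousAt.tendsto ?_)
      refine ContinuousAt.div (by fun_prop) (by fun_prop) ?_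
      simpa using hl.ne'
    have hval : (2 * C - 0 + C) / (l + 0) ^ 2 = 3 / 2 * l := by
      rw [hCl]
      field_simp
      ring
    rw [hval] at hcont
    obtain ⟨t, ht, ht0⟩ := ((hcont.eventually_const_lt hc).and self_mem_nhdsWithin).exists
    have ht0 : 0 < t := ht0
    have hlt : 2 * C < (l + t) ^ 3 := by
      rw [← hlC]
      gcongr
      linarith
    obtain ⟨b, hb1, hb2⟩ := exists_between hlt
    exact eventually_lt_log_chainCount_div hδ (by positivity) hC (by linarith) hb1 hb2 ht
  · refine eventually_log_chainCount_div_lt hδ hl hC (lt_of_eq_of_lt ?_ hc)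
    rw [hCl]
    field_simp
    ring

lemma zeta3_pos : 0 < zeta3 :=
  summable_inv_nat_succ_cube.tsum_pos (fun k => by positivity) 0 (by norm_num)

lemma leading_constant_eq {z : ℝ} (hz : 0 < z) :
    3 ^ ((4 : ℝ) / 3) * z ^ ((1 : ℝ) / 3) / (4 * π) ^ ((1 : ℝ) / 3) =
      3 / 2 * (2 * (z * (3 / π))) ^ ((1 : ℝ) / 3) := by
  have hp := pi_pos
  have h3 : ((3 : ℝ) ^ ((4 : ℝ) / 3)) ^ 3 = 81 := by
    rw [← rpow_natCast, ← rpow_mul (by norm_num)]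
    norm_num
  rw [← pow_left_inj₀ (by positivity) (by positivity) three_ne_zero, div_pow, mul_pow, mul_pow, h3,
    rpow_third_pow_three _ hz.le, rpow_third_pow_three _ (by positivity),
    rpow_third_pow_three _ (by positivity)]
  field_simp
  norm_num

/-- `ln(card Π̃_{n,n+δ}) = (3^{4/3}·ζ(3)^{1/3}/(4π)^{1/3})·n^{2/3}·(1 + o(1))` as `n → ∞`. -/
theorem statement11 (δ : ℝ) (hδ : 0 < δ) :
    (fun n : ℕ =>
        Real.log (Nat.card {ν : Xc →₀ ℕ // totalLength ν ∈ Set.Icc (n : ℝ) ((n : ℝ) + δ)}))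
      ~[atTop]
      (fun n : ℕ =>
        3 ^ ((4:ℝ)/3) * zeta3 ^ ((1:ℝ)/3) / (4 * π) ^ ((1:ℝ)/3) * (n : ℝ) ^ ((2:ℝ)/3)) := by
  have hζ := zeta3_pos
  have hC0 : 0 < 2 * (zeta3 * (3 / π)) := by positivity
  have hlim := tendsto_log_chainCount_div hδ (rpow_pos_of_pos hC0 _)
    (rpow_third_pow_three _ hC0.le) tendsto_sq_mul_logPartition
  have hk : 0 < 3 / 2 * (2 * (zeta3 * (3 / π))) ^ ((1 : ℝ) / 3) := by positivity
  rw [leading_constant_eq hζ]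
  refine isEquivalent_of_tendsto_one ?_
  have h1 := hlim.div_const (3 / 2 * (2 * (zeta3 * (3 / π))) ^ ((1 : ℝ) / 3))
  rw [div_self hk.ne'] at h1
  refine h1.congr fun n => ?_
  simp only [Pi.div_apply]
  rw [div_div, mul_comm ((n : ℝ) ^ ((2 : ℝ) / 3))]
  rfl
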